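/- arXiv:2605.13348 — 7 statements merged into one kernel-verified Lean document; each statement's English description precedes it below -/
import Mathlib

section
/- Additive collapse for harmonic p-sums: for all a, b in ℝ≥0∞, the function p ↦ a &ₚ b = (((a^p)⁻¹ + (b^p)⁻¹)⁻¹)^(1/p) tends to min a b as the real parameter p tends to +∞ (i.e. Tendsto (fun p : ℝ => (((a^p)⁻¹ + (b^p)⁻¹)⁻¹)^(1/p)) atTop (𝓝 (a ⊓ b)) in ℝ≥0∞). -/
open ENNReal Filter Topology

/-- The harmonic p-sum on `ℝ≥0∞`: `a &ₚ b = (((a^p)⁻¹ + (b^p)⁻¹)⁻¹)^(1/p)`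
(via `ENNReal.rpow`). -/
noncomputable def pCoSum (p : ℝ) (a b : ℝ≥0∞) : ℝ≥0∞ :=
  (((a ^ p)⁻¹ + (b ^ p)⁻¹)⁻¹) ^ (1 / p)

theorem pCoSum_comm (p : ℝ) (a b : ℝ≥0∞) : pCoSum p a b = pCoSum p b a := by
  simp only [pCoSum, add_comm]

theorem pCoSum_le_left {p : ℝ} (hp : 0 < p) (a b : ℝ≥0∞) : pCoSum p a b ≤ a := by
  rw [pCoSum, one_div, ENNReal.rpow_inv_le_iff hp, ENNReal.inv_le_iff_inv_le]
  exact le_self_add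

theorem two_inv_rpow_mul_le_pCoSum {p : ℝ} (hp : 0 < p) {a b : ℝ≥0∞} (hab : a ≤ b) :
    (2⁻¹ : ℝ≥0∞) ^ (1 / p) * a ≤ pCoSum p a b := by
  rw [pCoSum, one_div, ENNReal.le_rpow_inv_iff hp, ENNReal.mul_rpow_of_nonneg _ _ hp.le,
    ENNReal.rpow_inv_rpow hp.ne', ENNReal.le_inv_iff_le_inv,
    ENNReal.mul_inv (by simp) (by simp), inv_inv, two_mul]
  gcongr

theorem tendsto_two_inv_rpow_one_div :
    Tendsto (fun p : ℝ => (2⁻¹ : ℝ≥0∞) ^ (1 / p)) atTop (𝓝 1) := by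
  have h0 : Tendsto (fun p : ℝ => 1 / p) atTop (𝓝 0) := by
    simpa using tendsto_inv_atTop_zero (𝕜 := ℝ)
  have h : Tendsto (fun p : ℝ => (2⁻¹ : NNReal) ^ (1 / p)) atTop (𝓝 1) := by
    simpa using (tendsto_const_nhds (x := (2⁻¹ : NNReal))).nnrpow h0 (Or.inl (by simp))
  refine (ENNReal.tendsto_coe.mpr h).congr fun p => ?_
  rw [ENNReal.coe_rpow_of_ne_zero (by simp), ENNReal.coe_inv two_ne_zero, ENNReal.coe_ofNat]

theorem pCoSum_tendsto_left_of_le {a b : ℝ≥0∞} (hab : a ≤ b) :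
    Tendsto (fun p : ℝ => pCoSum p a b) atTop (𝓝 a) := by
  have h : Tendsto (fun p : ℝ => (2⁻¹ : ℝ≥0∞) ^ (1 / p) * a) atTop (𝓝 a) := by
    simpa using ENNReal.Tendsto.mul_const tendsto_two_inv_rpow_one_div
      (Or.inl one_ne_zero : (1 : ℝ≥0∞) ≠ 0 ∨ a ≠ ∞)
  refine tendsto_of_tendsto_of_tendsto_of_le_of_le' h tendsto_const_nhds ?_ ?_
  · filter_upwards [eventually_gt_atTop 0] with p hp using two_inv_rpow_mul_le_pCoSum hp hab
  · filter_upwards [eventually_gt_atTop 0] with p hp using pCoSum_le_left hp a b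

/-- Additive collapse: the harmonic p-sum tends to the min as `p → ∞`. -/
theorem pCoSum_tendsto_inf (a b : ℝ≥0∞) :
    Tendsto (fun p : ℝ => pCoSum p a b) atTop (𝓝 (a ⊓ b)) := by
  rcases le_total a b with hab | hba
  · rw [inf_eq_left.mpr hab]
    exact pCoSum_tendsto_left_of_le hab
  · rw [inf_eq_right.mpr hba]
    simpa only [pCoSum_comm _ a b] using pCoSum_tendsto_left_of_le hba
end

section
/- Residuation distributes over harmonic p-sums: let p be a real number with 0 < p < ∞. For all a, b, c in ℝ≥0∞, c ⊸ (a &ₚ b) = (c ⊸ a) &ₚ (c ⊸ b) and (a ⊕ₚ b) ⊸ c = (a ⊸ c) &ₚ (b ⊸ c), where a ⊸ b := a⁻¹ ⊗* b. -/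
open ENNReal

/-- The p-sum on `ℝ≥0∞`: `a ⊕ₚ b = (a^p + b^p)^(1/p)` (via `ENNReal.rpow`). -/
noncomputable def pSum (p : ℝ) (a b : ℝ≥0∞) : ℝ≥0∞ := (a ^ p + b ^ p) ^ (1 / p)

/-- Disjunctive multiplication on `ℝ≥0∞`: `a ⊗* b = (a⁻¹ * b⁻¹)⁻¹`. -/
noncomputable def tensorStar (a b : ℝ≥0∞) : ℝ≥0∞ := (a⁻¹ * b⁻¹)⁻¹

/-- Residuation on `ℝ≥0∞`: `a ⊸ b = a⁻¹ ⊗* b`. -/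
noncomputable def resid (a b : ℝ≥0∞) : ℝ≥0∞ := tensorStar a⁻¹ b

theorem mul_pSum {p : ℝ} (hp : 0 < p) (c a b : ℝ≥0∞) :
    c * pSum p a b = pSum p (c * a) (c * b) := by
  unfold pSum
  rw [ENNReal.mul_rpow_of_nonneg _ _ hp.le, ENNReal.mul_rpow_of_nonneg _ _ hp.le, ← mul_add,
    ENNReal.mul_rpow_of_nonneg _ _ (one_div_pos.mpr hp).le, one_div,
    ENNReal.rpow_rpow_inv hp.ne']

theorem pCoSum_eq_inv_pSum_inv (p : ℝ) (a b : ℝ≥0∞) :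
    pCoSum p a b = (pSum p a⁻¹ b⁻¹)⁻¹ := by
  simp only [pCoSum, pSum, ENNReal.inv_rpow]

theorem resid_eq_inv_mul_inv (a b : ℝ≥0∞) : resid a b = (a * b⁻¹)⁻¹ := by
  simp only [resid, tensorStar, inv_inv]

/-- Residuation distributes over harmonic p-sums. -/
theorem resid_pCoSum_distrib (p : ℝ) (hp : 0 < p) (a b c : ℝ≥0∞) :
    resid c (pCoSum p a b) = pCoSum p (resid c a) (resid c b) ∧
    resid (pSum p a b) c = pCoSum p (resid a c) (resid b c) := by
  simp only [pCoSum_eq_inv_pSum_inv, resid_eq_inv_mul_inv, inv_inv]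
  refine ⟨by rw [mul_pSum hp], ?_⟩
  rw [mul_comm, mul_pSum hp, mul_comm a, mul_comm b]
end

section
/- Cross-distributivity of the multiplications over the additive operations: let p be a real number with 0 < p < ∞. For all a, b, c in ℝ≥0∞, (a ⊗* b) ⊕ₚ (a ⊗* c) = a ⊗* (b ⊕ₚ c) and (a·b) &ₚ (a·c) = a·(b &ₚ c), where · is ENNReal multiplication and a ⊗* b := (a⁻¹ · b⁻¹)⁻¹. -/
open ENNReal

theorem tensorStar_add (a b c : ℝ≥0∞) :
    tensorStar a (b + c) = tensorStar a b + tensorStar a c := by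
  unfold tensorStar
  rcases eq_or_ne a 0 with rfl | ha
  · by_cases hb : b = ∞ <;> by_cases hc : c = ∞ <;> simp [ENNReal.top_mul, hb, hc]
  rcases eq_or_ne a ∞ with rfl | ha'
  · simp
  have key (x : ℝ≥0∞) : (a⁻¹ * x⁻¹)⁻¹ = a * x := by
    rw [ENNReal.mul_inv (by simp [ha']) (by simp [ha]), inv_inv, inv_inv]
  rw [key, key, key, mul_add]

theorem tensorStar_rpow (a b : ℝ≥0∞) {p : ℝ} (hp : 0 ≤ p) :
    tensorStar a b ^ p = tensorStar (a ^ p) (b ^ p) := by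
  simp only [tensorStar, ENNReal.inv_rpow, ENNReal.mul_rpow_of_nonneg _ _ hp]

theorem pSum_tensorStar {p : ℝ} (hp : 0 < p) (a b c : ℝ≥0∞) :
    pSum p (tensorStar a b) (tensorStar a c) = tensorStar a (pSum p b c) := by
  unfold pSum
  rw [tensorStar_rpow a b hp.le, tensorStar_rpow a c hp.le, ← tensorStar_add,
    tensorStar_rpow _ _ (one_div_nonneg.2 hp.le), one_div, ENNReal.rpow_rpow_inv hp.ne']

theorem inv_mul_eq_tensorStar_inv (a b : ℝ≥0∞) : (a * b)⁻¹ = tensorStar a⁻¹ b⁻¹ := by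
  simp only [tensorStar, inv_inv]

/-- Cross-distributivity of the multiplications over the additive operations. -/
theorem cross_distrib (p : ℝ) (hp : 0 < p) (a b c : ℝ≥0∞) :
    pSum p (tensorStar a b) (tensorStar a c) = tensorStar a (pSum p b c) ∧
    pCoSum p (a * b) (a * c) = a * pCoSum p b c := by
  refine ⟨pSum_tensorStar hp a b c, ?_⟩
  rw [pCoSum_eq_inv_pSum_inv, pCoSum_eq_inv_pSum_inv, inv_mul_eq_tensorStar_inv,
    inv_mul_eq_tensorStar_inv, pSum_tensorStar hp, tensorStar, inv_inv, inv_inv]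
end

section
/- Linear distributivity and the isomix property: for all a, b, c in ℝ≥0∞, (a ⊗* b)·c ≤ a ⊗* (b·c), and a·b ≤ a ⊗* b, where · is ENNReal multiplication and a ⊗* b := (a⁻¹ · b⁻¹)⁻¹. -/
open ENNReal

@[simp]
theorem tensorStar_top_left (b : ℝ≥0∞) : tensorStar ∞ b = ∞ := by simp [tensorStar]

@[simp]
theorem tensorStar_top_right (a : ℝ≥0∞) : tensorStar a ∞ = ∞ := by simp [tensorStar]

theorem tensorStar_eq_mul {a b : ℝ≥0∞} (ha : a ≠ ∞) (hb : b ≠ ∞) :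
    tensorStar a b = a * b := by
  rw [tensorStar, ← ENNReal.mul_inv (Or.inr hb) (Or.inl ha), inv_inv]

theorem mul_le_tensorStar (a b : ℝ≥0∞) : a * b ≤ tensorStar a b := by
  by_cases ha : a = ∞
  · simp [ha]
  by_cases hb : b = ∞
  · simp [hb]
  exact (tensorStar_eq_mul ha hb).ge

theorem tensorStar_mul_le (a b c : ℝ≥0∞) : tensorStar a b * c ≤ tensorStar a (b * c) := by
  by_cases hc : c = 0
  · simp [hc]
  by_cases ha : a = ∞
  · simp [ha]
  by_cases hb : b = ∞
  · simp [hb, ENNReal.top_mul hc]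
  rw [tensorStar_eq_mul ha hb, mul_assoc]
  exact mul_le_tensorStar a (b * c)

/-- Linear distributivity and the isomix property. -/
theorem linear_distrib_and_isomix (a b c : ℝ≥0∞) :
    tensorStar a b * c ≤ tensorStar a (b * c) ∧ a * b ≤ tensorStar a b :=
  ⟨tensorStar_mul_le a b c, mul_le_tensorStar a b⟩
end

section
/- Residuation adjunction in the multiplicative extended nonnegative reals: for all a, b, c in ℝ≥0∞, a ≤ b ⊸ c if and only if a·b ≤ c, where a ⊸ b := a⁻¹ ⊗* b and · is ENNReal multiplication. -/
open ENNReal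

/-- Residuation adjunction in the multiplicative extended nonnegative reals. -/
theorem resid_adjunction (a b c : ℝ≥0∞) : a ≤ resid b c ↔ a * b ≤ c := by
  rw [resid, tensorStar, inv_inv, le_inv_iff_mul_le, ← mul_assoc, ← div_eq_mul_inv,
    ENNReal.div_le_iff_le_mul (.inr one_ne_top) (.inr one_ne_zero), one_mul]
end

section
/- The soft max-product inequality: let p be a real number with 0 < p < ∞. For all a, b, c, d in ℝ≥0∞, (a ⊕ₚ b)·(c &ₚ d) ≤ (a·c) ⊔ (b·d), where · is ENNReal multiplication (with 0·∞ = 0). -/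
open ENNReal

/-- The case `p = 1` of the soft max-product inequality. -/
theorem add_mul_inv_add_inv_le_max (a b c d : ℝ≥0∞) :
    (a + b) * (c⁻¹ + d⁻¹)⁻¹ ≤ (a * c) ⊔ (b * d) := by
  rcases eq_or_ne c 0 with rfl | hc
  · simp
  rcases eq_or_ne d 0 with rfl | hd
  · simp
  rcases eq_or_ne ((a * c) ⊔ (b * d)) ⊤ with hM | hM
  · rw [hM]
    exact le_top
  have ha : a ≤ ((a * c) ⊔ (b * d)) / c :=
    (ENNReal.le_div_iff_mul_le (Or.inl hc) (Or.inr hM)).2 le_sup_left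
  have hb : b ≤ ((a * c) ⊔ (b * d)) / d :=
    (ENNReal.le_div_iff_mul_le (Or.inl hd) (Or.inr hM)).2 le_sup_right
  rw [← div_eq_mul_inv]
  apply ENNReal.div_le_of_le_mul
  rw [mul_add, ← div_eq_mul_inv, ← div_eq_mul_inv]
  exact add_le_add ha hb

/-- The soft max-product inequality. -/
theorem soft_max_product (p : ℝ) (hp : 0 < p) (a b c d : ℝ≥0∞) :
    pSum p a b * pCoSum p c d ≤ (a * c) ⊔ (b * d) := by
  have h1p : 0 ≤ 1 / p := by positivity
  unfold pSum pCoSum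
  rw [← ENNReal.mul_rpow_of_nonneg _ _ h1p, one_div, ENNReal.rpow_inv_le_iff hp,
    (ENNReal.monotone_rpow_of_nonneg hp.le).map_sup, ENNReal.mul_rpow_of_nonneg _ _ hp.le,
    ENNReal.mul_rpow_of_nonneg _ _ hp.le]
  exact add_mul_inv_add_inv_le_max _ _ _ _
end

section
/- Dual cancellation: let p be a real number with 0 < p < ∞. For all x, y in ℝ≥0∞, one has 1 ≤ (1 ⊕ₚ x) &ₚ (y ⊕ₚ 1) if and only if x⁻¹ ≤ y; moreover, if x⁻¹ = y then (1 ⊕ₚ x) &ₚ (y ⊕ₚ 1) = 1. -/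
open ENNReal

theorem ENNReal.inv_one_add_add_inv_inv_add_one (u : ℝ≥0∞) :
    (1 + u)⁻¹ + (u⁻¹ + 1)⁻¹ = 1 := by
  rcases eq_or_ne u 0 with rfl | h0
  · simp
  rcases eq_or_ne u ∞ with rfl | ht
  · simp
  have h : (u⁻¹ + 1)⁻¹ = u * (1 + u)⁻¹ := by
    have h' : u⁻¹ + 1 = u⁻¹ * (1 + u) := by
      rw [mul_add, mul_one, ENNReal.inv_mul_cancel h0 ht]
    rw [h', ENNReal.mul_inv (Or.inl (ENNReal.inv_ne_zero.2 ht)) (Or.inl (ENNReal.inv_ne_top.2 h0)),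
      inv_inv]
  rw [h, ← one_add_mul, ENNReal.mul_inv_cancel (by simp) (by simp [ht])]

theorem ENNReal.inv_one_add_add_inv_add_one_le_one_iff (u v : ℝ≥0∞) :
    (1 + u)⁻¹ + (v + 1)⁻¹ ≤ 1 ↔ u⁻¹ ≤ v := by
  conv_lhs => rhs; rw [← ENNReal.inv_one_add_add_inv_inv_add_one u]
  rw [ENNReal.add_le_add_iff_left (by simp), ENNReal.inv_le_inv,
    ENNReal.add_le_add_iff_right one_ne_top]

theorem pCoSum_pSum_one (p : ℝ) (hp : 0 < p) (x y : ℝ≥0∞) :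
    pCoSum p (pSum p 1 x) (pSum p y 1) =
      (((1 + x ^ p)⁻¹ + (y ^ p + 1)⁻¹)⁻¹) ^ (1 / p) := by
  simp only [pCoSum, pSum, ENNReal.one_rpow, one_div, ENNReal.rpow_inv_rpow hp.ne']

/-- Dual cancellation. -/
theorem dual_cancellation (p : ℝ) (hp : 0 < p) (x y : ℝ≥0∞) :
    (1 ≤ pCoSum p (pSum p 1 x) (pSum p y 1) ↔ x⁻¹ ≤ y) ∧
    (x⁻¹ = y → pCoSum p (pSum p 1 x) (pSum p y 1) = 1) := by
  rw [pCoSum_pSum_one p hp]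
  refine ⟨?_, ?_⟩
  · rw [one_div, ENNReal.le_rpow_inv_iff hp, ENNReal.one_rpow, ENNReal.one_le_inv,
      ENNReal.inv_one_add_add_inv_add_one_le_one_iff, ← ENNReal.inv_rpow,
      ENNReal.rpow_le_rpow_iff hp]
  · rintro rfl
    rw [ENNReal.inv_rpow x, ENNReal.inv_one_add_add_inv_inv_add_one, inv_one, ENNReal.one_rpow]
end
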